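/- Let L be a nondegenerate primitive sublattice of the K3 lattice Λ_K3 of signature (1, rank(L)−1), and let I be a doubly admissible primitive rank-2 isotropic sublattice of L^⊥. Then: (1) there is a primitive isometric embedding j : H ⊕ E₈ ⊕ E₈ ↪ I^⊥ with L ⊆ im(j), such that the composition of j with the quotient map I^⊥ → I^⊥/I is an isomorphism of lattices; in particular, L embeds primitively into I^⊥/I. (2) There is an orthogonal direct-sum decomposition L^⊥ = M ⊕ Γ in which M is a primitive sublattice of L^⊥ isometric to H ⊕ H containing I as a primitive sublattice, and Γ is negative definite. -/

import Mathlib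

/- Background definitions: integral lattices, the hyperbolic plane `H`, the
   `E₈` lattice, the K3 lattice `Λ_K3 = H ⊕ H ⊕ H ⊕ E₈ ⊕ E₈`, primitivity,
   isotropy, and (doubly) admissible classes. -/

namespace DF

/-- Integer bilinear form on a `ℤ`-module. -/
abbrev Bil (G : Type) [AddCommGroup G] := G →ₗ[ℤ] G →ₗ[ℤ] ℤ

section Defs

variable {G G' : Type} [AddCommGroup G] [AddCommGroup G']

/-- A primitive element of a free `ℤ`-module. -/
def PrimElt (p : G) : Prop := ∀ (n : ℤ) (x : G), p = n • x → IsUnit n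

/-- A primitive subgroup (torsion-free quotient). -/
def PrimSub (S : Submodule ℤ G) : Prop :=
  ∀ (n : ℤ) (x : G), n ≠ 0 → n • x ∈ S → x ∈ S

/-- `S` is a primitive subgroup of `T` (i.e. `T/S` is torsion-free). -/
def PrimIn (S T : Submodule ℤ G) : Prop :=
  ∀ (n : ℤ) (x : G), n ≠ 0 → x ∈ T → n • x ∈ S → x ∈ S

/-- `e` is a primitive element of the subgroup `S`. -/
def PrimEltIn (S : Submodule ℤ G) (e : G) : Prop :=
  ∀ (n : ℤ) (x : G), x ∈ S → e = n • x → IsUnit n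

/-- The bilinear form vanishes identically on `S`. -/
def IsotropicSub (B : Bil G) (S : Submodule ℤ G) : Prop :=
  ∀ x ∈ S, ∀ y ∈ S, B x y = 0

/-- The restriction of `B` to `S` is nondegenerate. -/
def NondegOn (B : Bil G) (S : Submodule ℤ G) : Prop :=
  ∀ x ∈ S, (∀ y ∈ S, B x y = 0) → x = 0

/-- The (two-sided) orthogonal complement of a submodule. -/
def perpSub (B : Bil G) (S : Submodule ℤ G) : Submodule ℤ G where
  carrier := {v | ∀ s ∈ S, B s v = 0 ∧ B v s = 0}
  zero_mem' := by intro s hs; simp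
  add_mem' := by
    intro x y hx hy s hs
    obtain ⟨h1, h2⟩ := hx s hs; obtain ⟨h3, h4⟩ := hy s hs
    constructor <;> simp [map_add, LinearMap.add_apply, h1, h2, h3, h4]
  smul_mem' := by
    intro c x hx s hs
    obtain ⟨h1, h2⟩ := hx s hs
    constructor <;> simp [map_smul, LinearMap.smul_apply, smul_eq_mul, h1, h2]

/-- The submodule `N` of `(G, B)` is isometric to the lattice `(G', B')`. -/
def IsometricTo (B : Bil G) (N : Submodule ℤ G) (B' : Bil G') : Prop :=
  ∃ e : G' ≃ₗ[ℤ] ↥N, ∀ u v : G', B ((e u : ↥N) : G) ((e v : ↥N) : G) = B' u v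

/-- `div(e) = m` in `S`: the image of `⟨e, -⟩ : S → ℤ` is generated by `m`. -/
def DivEq (B : Bil G) (S : Submodule ℤ G) (e : G) (m : ℤ) : Prop :=
  (∀ x ∈ S, m ∣ B e x) ∧ ∃ x ∈ S, B e x = m

/-- `e` is an `m`-admissible class of the (nondegenerate) lattice `S`:
    `e ∈ S` is primitive isotropic with `div(e) = m`, and there is an
    isotropic `g ∈ S` with `div(g) = m` and `⟨e, g⟩ = m`. -/
def MAdm (B : Bil G) (S : Submodule ℤ G) (e : G) (m : ℤ) : Prop :=
  e ∈ S ∧ PrimEltIn S e ∧ B e e = 0 ∧ DivEq B S e m ∧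
  ∃ g ∈ S, B g g = 0 ∧ DivEq B S g m ∧ B e g = m

/-- The rank-two isotropic sublattice `I` of `S` is doubly admissible in `S`:
    there are primitive generators `e₁, e₂` of `I` and isotropic classes
    `g₁, g₂ ∈ S` with `⟨e₁,g₁⟩ = ⟨e₂,g₂⟩ = 1` and `⟨e₁,g₂⟩ = ⟨e₂,g₁⟩ = 0`. -/
def DoublyAdm (B : Bil G) (S : Submodule ℤ G) (I : Submodule ℤ G) : Prop :=
  ∃ e₁ e₂ g₁ g₂ : G, e₁ ∈ S ∧ e₂ ∈ S ∧ g₁ ∈ S ∧ g₂ ∈ S ∧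
    PrimEltIn S e₁ ∧ PrimEltIn S e₂ ∧ I = Submodule.span ℤ {e₁, e₂} ∧
    B g₁ g₁ = 0 ∧ B g₂ g₂ = 0 ∧
    B e₁ g₁ = 1 ∧ B e₂ g₂ = 1 ∧ B e₁ g₂ = 0 ∧ B e₂ g₁ = 0

/-- Signature `(1, rank - 1)` for the sublattice `L`:
    there is a rationally spanning pairwise orthogonal family in `L` with one
    vector of positive square and `rank L - 1` of negative square. -/
def SigOneRest (B : Bil G) (L : Submodule ℤ G) : Prop :=
  1 ≤ Module.finrank ℤ ↥L ∧
  ∃ (v₀ : G) (w : Fin (Module.finrank ℤ ↥L - 1) → G),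
    v₀ ∈ L ∧ (∀ i, w i ∈ L) ∧ 0 < B v₀ v₀ ∧ (∀ i, B (w i) (w i) < 0) ∧
    (∀ i, B v₀ (w i) = 0) ∧ (∀ i j, i ≠ j → B (w i) (w j) = 0) ∧
    ∀ u ∈ L, ∃ m : ℤ, m ≠ 0 ∧ m • u ∈ Submodule.span ℤ (insert v₀ (Set.range w))

end Defs

section Lattices

variable {G₁ G₂ : Type} [AddCommGroup G₁] [AddCommGroup G₂]

/-- The orthogonal direct sum of two bilinear forms. -/
def prodForm (B₁ : Bil G₁) (B₂ : Bil G₂) : Bil (G₁ × G₂) :=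
  LinearMap.mk₂ ℤ (fun u v => B₁ u.1 v.1 + B₂ u.2 v.2)
    (by intro m₁ m₂ n; simp [map_add, LinearMap.add_apply]; ring)
    (by intro c m n; simp [map_smul, LinearMap.smul_apply, smul_eq_mul]; ring)
    (by intro m n₁ n₂; simp [map_add, LinearMap.add_apply]; ring)
    (by intro c m n; simp [map_smul, LinearMap.smul_apply, smul_eq_mul]; ring)

/-- The hyperbolic plane `H`: `ℤ²` with Gram matrix `!![0, 1; 1, 0]`. -/
def HForm : Bil (Fin 2 → ℤ) :=
  LinearMap.mk₂ ℤ (fun x y => x 0 * y 1 + x 1 * y 0)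
    (by intro m₁ m₂ n; simp [Pi.add_apply]; ring)
    (by intro c m n; simp [Pi.smul_apply, smul_eq_mul]; ring)
    (by intro m n₁ n₂; simp [Pi.add_apply]; ring)
    (by intro c m n; simp [Pi.smul_apply, smul_eq_mul]; ring)

/-- The negative of the `E₈` Cartan matrix (Bourbaki numbering). -/
def E8Gram : Matrix (Fin 8) (Fin 8) ℤ :=
  !![-2,  0,  1,  0,  0,  0,  0,  0;
      0, -2,  0,  1,  0,  0,  0,  0;
      1,  0, -2,  1,  0,  0,  0,  0;
      0,  1,  1, -2,  1,  0,  0,  0;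
      0,  0,  0,  1, -2,  1,  0,  0;
      0,  0,  0,  0,  1, -2,  1,  0;
      0,  0,  0,  0,  0,  1, -2,  1;
      0,  0,  0,  0,  0,  0,  1, -2]

/-- The negative definite even unimodular root lattice `E₈`. -/
def E8Form : Bil (Fin 8 → ℤ) := Matrix.toLinearMap₂' ℤ E8Gram

/-- The underlying group of `H ⊕ H`. -/
abbrev HHtype := (Fin 2 → ℤ) × (Fin 2 → ℤ)

/-- The lattice `H ⊕ H`. -/
def HHForm : Bil HHtype := prodForm HForm HForm

/-- The underlying group of `H ⊕ E₈ ⊕ E₈`. -/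
abbrev HEEtype := (Fin 2 → ℤ) × (Fin 8 → ℤ) × (Fin 8 → ℤ)

/-- The lattice `H ⊕ E₈ ⊕ E₈`. -/
def HEEForm : Bil HEEtype := prodForm HForm (prodForm E8Form E8Form)

/-- The underlying group of the K3 lattice `Λ_K3 = H ⊕ H ⊕ H ⊕ E₈ ⊕ E₈`. -/
abbrev K3type := (Fin 2 → ℤ) × (Fin 2 → ℤ) × (Fin 2 → ℤ) × (Fin 8 → ℤ) × (Fin 8 → ℤ)

/-- The K3 lattice `Λ_K3 = H ⊕ H ⊕ H ⊕ E₈ ⊕ E₈`. -/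
def K3Form : Bil K3type :=
  prodForm HForm (prodForm HForm (prodForm HForm (prodForm E8Form E8Form)))

end Lattices

end DF

namespace DF

section Eichler

variable {G : Type} [AddCommGroup G]

/-- A linear automorphism preserving the form. -/
def IsIsometry (B : Bil G) (φ : G ≃ₗ[ℤ] G) : Prop := ∀ x y, B (φ x) (φ y) = B x y

theorem IsIsometry.trans {B : Bil G} {φ ψ : G ≃ₗ[ℤ] G} (hφ : IsIsometry B φ)
    (hψ : IsIsometry B ψ) : IsIsometry B (φ.trans ψ) := fun x y => by
  rw [LinearEquiv.trans_apply, LinearEquiv.trans_apply, hψ, hφ]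

/-- The Eichler transvection attached to an isotropic `e` and some `a ⊥ e` with `a² = 2q`. -/
theorem exists_transvection {B : Bil G} (hs : ∀ x y, B x y = B y x) {e a : G} {q : ℤ}
    (he : B e e = 0) (ha : B a e = 0) (hq : B a a = 2 * q) :
    ∃ φ : G ≃ₗ[ℤ] G, IsIsometry B φ ∧
      ∀ y, φ y = y + B y e • a - B y a • e - (q * B y e) • e := by
  have ha' : B e a = 0 := by rw [hs, ha]
  let T : G → G →ₗ[ℤ] G := fun b =>
    LinearMap.id + (B.flip e).smulRight b - (B.flip b).smulRight e - (q • B.flip e).smulRight e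
  have hT : ∀ b y, T b y = y + B y e • b - B y b • e - (q * B y e) • e := fun b y => by
    simp [T]
  have hTe : ∀ b y, B b e = 0 → B (T b y) e = B y e := fun b y hb => by
    simp [hT, hb, he]
  have hTa : ∀ y, B (T a y) a = B y a + 2 * q * B y e := fun y => by
    simp [hT, ha', hq]; ring
  have hTa' : ∀ y, B (T (-a) y) a = B y a - 2 * q * B y e := fun y => by
    simp [hT, ha', hq]; ring
  refine ⟨LinearEquiv.ofLinearMap (T a) (T (-a)) ?_ ?_, ?_, hT a⟩
  · ext y
    rw [LinearMap.comp_apply, hT a, hTe _ _ (by simp [ha]), hTa', hT (-a), map_neg,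
      LinearMap.id_apply]
    module
  · ext y
    rw [LinearMap.comp_apply, hT (-a), hTe _ _ ha, map_neg, hTa, hT a, LinearMap.id_apply]
    module
  · intro x y
    change B (T a x) (T a y) = B x y
    simp only [hT, map_add, map_sub, map_smul, LinearMap.add_apply, LinearMap.sub_apply,
      LinearMap.smul_apply, smul_eq_mul, he, ha, ha', hq, hs e y, hs a y]
    ring

/-- `e₁, f₁, e₂, f₂` span two mutually orthogonal hyperbolic planes. -/
structure TwoHyp (B : Bil G) (e₁ f₁ e₂ f₂ : G) : Prop where
  ee : B e₁ e₁ = 0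
  ff : B f₁ f₁ = 0
  ef : B e₁ f₁ = 1
  ee' : B e₂ e₂ = 0
  ff' : B f₂ f₂ = 0
  ef' : B e₂ f₂ = 1
  e₁e₂ : B e₁ e₂ = 0
  e₁f₂ : B e₁ f₂ = 0
  f₁e₂ : B f₁ e₂ = 0
  f₁f₂ : B f₁ f₂ = 0

theorem TwoHyp.flip {B : Bil G} (hs : ∀ x y, B x y = B y x) {e₁ f₁ e₂ f₂ : G}
    (h : TwoHyp B e₁ f₁ e₂ f₂) : TwoHyp B e₁ f₁ f₂ e₂ :=
  ⟨h.ee, h.ff, h.ef, h.ff', h.ee', by rw [hs, h.ef'], h.e₁f₂, h.e₁e₂, h.f₁f₂, h.f₁e₂⟩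

/-- Any coordinate along the second plane can be moved to the first one. -/
theorem exists_isometry_coord {B : Bil G} (hs : ∀ x y, B x y = B y x) {e₁ f₁ e₂ f₂ : G}
    (h : TwoHyp B e₁ f₁ e₂ f₂) (v : G) :
    ∃ φ, IsIsometry B φ ∧ B (φ v) f₁ = B v f₂ := by
  obtain ⟨φ, hφ, hφ'⟩ := exists_transvection hs (e := f₂) (a := -e₁) (q := 0) h.ff'
    (by simp [h.e₁f₂]) (by simp [h.ee])
  obtain ⟨ψ, hψ, hψ'⟩ := exists_transvection hs (e := f₁) (a := e₂) (q := 0) h.ff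
    (by rw [hs, h.f₁e₂]) (by simp [h.ee'])
  have key : ψ (φ f₁) = f₂ := by
    rw [hφ', hψ']
    simp [hs f₁ e₁, hs f₂ e₂, hs f₂ f₁, h.ef, h.ef', h.ff, h.f₁f₂, h.f₁e₂]
  refine ⟨(φ.trans ψ).symm, ?_, ?_⟩
  · intro x y
    rw [← (hφ.trans hψ) ((φ.trans ψ).symm x)]
    simp
  · rw [← (hφ.trans hψ) ((φ.trans ψ).symm v)]
    simp [key]

/-- An isometry adds any multiple of the first coordinate to a coordinate along the second plane. -/
theorem exists_isometry_shear {B : Bil G} (hs : ∀ x y, B x y = B y x) {e₁ f₁ e₂ f₂ : G}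
    (h : TwoHyp B e₁ f₁ e₂ f₂) (w : G) (k : ℤ) :
    ∃ φ, IsIsometry B φ ∧ B (φ w) f₁ = B w f₁ ∧ B (φ w) f₂ = B w f₂ + k * B w f₁ ∧
      B (φ w) e₂ = B w e₂ := by
  obtain ⟨φ, hφ, hφ'⟩ := exists_transvection hs (e := f₁) (a := k • e₂) (q := 0) h.ff
    (by simp [hs e₂ f₁, h.f₁e₂]) (by simp [h.ee'])
  refine ⟨φ, hφ, ?_, ?_, ?_⟩ <;> rw [hφ'] <;>
    simp [h.ff, h.ee', h.ef', hs e₂ f₁, h.f₁e₂, h.f₁f₂, mul_comm]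

/-- A vector orthogonal to the second plane can be given second-plane coordinate `-1`. -/
theorem exists_isometry_dual {B : Bil G} (hs : ∀ x y, B x y = B y x)
    (hev : ∀ x, ∃ q, B x x = 2 * q) {e₁ f₁ e₂ f₂ : G}
    (h : TwoHyp B e₁ f₁ e₂ f₂) (w g : G) (hwg : B w g = 1) (hf : B w f₂ = 0) (he : B w e₂ = 0) :
    ∃ φ, IsIsometry B φ ∧ B (φ w) f₁ = B w f₁ ∧ B (φ w) f₂ = -1 := by
  obtain ⟨q, hq⟩ := hev (g - B g e₂ • f₂)
  obtain ⟨φ, hφ, hφ'⟩ := exists_transvection hs (e := e₂) (a := g - B g e₂ • f₂) (q := q) h.ee'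
    (by simp [hs f₂ e₂, h.ef']) hq
  have hw : φ w = w - e₂ := by
    rw [hφ', he, map_sub, map_smul, hf, hwg]
    module
  refine ⟨φ, hφ, ?_, ?_⟩ <;> rw [hw] <;> simp [hs e₂ f₁, h.f₁e₂, h.ef', hf]

/-- An isometry moves a vector with a dual partner to one with first coordinate `1`. -/
theorem exists_isometry_coord_one {B : Bil G} (hs : ∀ x y, B x y = B y x)
    (hev : ∀ x, ∃ q, B x x = 2 * q)
    {e₁ f₁ e₂ f₂ : G} (h : TwoHyp B e₁ f₁ e₂ f₂) (v g : G) (hvg : B v g = 1) :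
    ∃ φ, IsIsometry B φ ∧ B (φ v) f₁ = 1 := by
  classical
  let P : G → Prop := fun w => ∃ φ, IsIsometry B φ ∧ φ v = w
  have hPv : P v := ⟨LinearEquiv.refl ℤ G, fun _ _ => rfl, rfl⟩
  have hPm : ∀ w, P w → ∀ ψ, IsIsometry B ψ → P (ψ w) := by
    rintro _ ⟨φ, hφ, rfl⟩ ψ hψ
    exact ⟨φ.trans ψ, hφ.trans hψ, rfl⟩
  have hPn : ∀ w, P w → P (-w) := fun w hw =>
    hPm w hw (LinearEquiv.neg ℤ) (fun x y => by simp)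
  have hPg : ∀ w, P w → ∃ g', B w g' = 1 := by
    rintro _ ⟨φ, hφ, rfl⟩
    exact ⟨φ g, by rw [hφ, hvg]⟩
  let S : ℕ → Prop := fun n => 0 < n ∧ ∃ w, P w ∧ B w f₁ = n
  have hS : ∀ w, P w → B w f₁ ≠ 0 → S (B w f₁).natAbs := fun w hw h0 => by
    refine ⟨Int.natAbs_pos.2 h0, ?_⟩
    rcases Int.natAbs_eq (B w f₁) with h1 | h1
    · exact ⟨w, hw, h1⟩
    · exact ⟨-w, hPn w hw, by rw [map_neg, LinearMap.neg_apply]; omega⟩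
  have hPf : ∀ w, P w → ∃ w', P w' ∧ B w' f₁ = B w f₂ := fun w hw => by
    obtain ⟨φ, hφ, h1⟩ := exists_isometry_coord hs h w
    exact ⟨_, hPm w hw φ hφ, h1⟩
  have hPe : ∀ w, P w → ∃ w', P w' ∧ B w' f₁ = B w e₂ := fun w hw => by
    obtain ⟨φ, hφ, h1⟩ := exists_isometry_coord hs (h.flip hs) w
    exact ⟨_, hPm w hw φ hφ, h1⟩
  have hex : ∃ n, S n := by
    by_contra hno
    have h0 : ∀ w, P w → B w f₁ = 0 := fun w hw => by
      by_contra h1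
      exact hno ⟨_, hS w hw h1⟩
    have hf : ∀ w, P w → B w f₂ = 0 := fun w hw => by
      obtain ⟨w', hw', h1⟩ := hPf w hw
      rw [← h1, h0 w' hw']
    have he : B v e₂ = 0 := by
      obtain ⟨w', hw', h1⟩ := hPe v hPv
      rw [← h1, h0 w' hw']
    obtain ⟨φ, hφ, -, h1⟩ := exists_isometry_dual hs hev h v g hvg (hf v hPv) he
    have := hf _ (hPm v hPv φ hφ)
    omega
  obtain ⟨m, ⟨hm, w, hw, hwm⟩, hmin⟩ : ∃ m, S m ∧ ∀ n, S n → m ≤ n :=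
    ⟨Nat.find hex, Nat.find_spec hex, fun n hn => Nat.find_min' hex hn⟩
  have hsmall : ∀ w, P w → 0 ≤ B w f₁ → B w f₁ < m → B w f₁ = 0 := fun w hw h1 h2 => by
    by_contra h3
    have := hmin _ (hS w hw h3)
    omega
  have hdvd : ∀ w, P w → B w f₁ = m → (m : ℤ) ∣ B w f₂ ∧ (m : ℤ) ∣ B w e₂ := by
    intro w hw hwm
    constructor
    · obtain ⟨φ, hφ, -, h1, -⟩ := exists_isometry_shear hs h w (-(B w f₂ / m))
      obtain ⟨w', hw', h2⟩ := hPf _ (hPm w hw φ hφ)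
      have h3 : B w' f₁ = B w f₂ % m := by
        rw [h2, h1, hwm, Int.emod_def]; ring
      have := hsmall w' hw' (by rw [h3]; exact Int.emod_nonneg _ (by omega))
        (by rw [h3]; exact Int.emod_lt_of_pos _ (by omega))
      exact Int.dvd_of_emod_eq_zero (by rw [← h3, this])
    · obtain ⟨φ, hφ, -, h1, -⟩ := exists_isometry_shear hs (h.flip hs) w (-(B w e₂ / m))
      obtain ⟨w', hw', h2⟩ := hPe _ (hPm w hw φ hφ)
      have h3 : B w' f₁ = B w e₂ % m := by
        rw [h2, h1, hwm, Int.emod_def]; ring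
      have := hsmall w' hw' (by rw [h3]; exact Int.emod_nonneg _ (by omega))
        (by rw [h3]; exact Int.emod_lt_of_pos _ (by omega))
      exact Int.dvd_of_emod_eq_zero (by rw [← h3, this])
  obtain ⟨⟨c, hc⟩, ⟨d, hd⟩⟩ := hdvd w hw hwm
  obtain ⟨φ, hφ, h1, h2, h3⟩ := exists_isometry_shear hs h w (-c)
  obtain ⟨ψ, hψ, h4, h5, h6⟩ := exists_isometry_shear hs (h.flip hs) (φ w) (-d)
  have hPu := hPm _ (hPm w hw φ hφ) ψ hψ
  obtain ⟨g', hg'⟩ := hPg _ hPu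
  obtain ⟨χ, hχ, h7, h8⟩ := exists_isometry_dual hs hev h _ g' hg'
    (by rw [h6, h2, hc, hwm]; ring) (by rw [h5, h3, h1, hd, hwm]; ring)
  have hPz := hPm _ hPu χ hχ
  have hzm : B (χ (ψ (φ w))) f₁ = m := by rw [h7, h4, h1, hwm]
  have hone : (m : ℤ) ∣ -1 := h8 ▸ (hdvd _ hPz hzm).1
  have hm1 : (m : ℤ) = 1 :=
    Int.eq_one_of_dvd_one (by omega) (by simpa using hone)
  obtain ⟨ρ, hρ, hρv⟩ := hPz
  exact ⟨ρ, hρ, by rw [hρv, hzm, hm1]⟩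

/-- Isometries act transitively on isotropic vectors with a dual partner when the lattice is even
and splits two hyperbolic planes. -/
theorem exists_isometry_vec {B : Bil G} (hs : ∀ x y, B x y = B y x)
    (hev : ∀ x, ∃ q, B x x = 2 * q)
    {e₁ f₁ e₂ f₂ : G} (h : TwoHyp B e₁ f₁ e₂ f₂) (v g : G) (hv : B v v = 0)
    (hvg : B v g = 1) : ∃ φ, IsIsometry B φ ∧ φ v = e₁ := by
  obtain ⟨φ, hφ, h1⟩ := exists_isometry_coord_one hs hev h v g hvg
  set w := φ v with hw
  have hww : B w w = 0 := by rw [hw, hφ, hv]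
  let x := w - e₁ - B w e₁ • f₁
  obtain ⟨q, hq⟩ := hev x
  have hxf : B x f₁ = 0 := by simp [x, h1, h.ef, h.ff]
  have hxe : B x e₁ = 0 := by simp [x, hs f₁ e₁, h.ef, h.ee]
  obtain ⟨ψ, hψ, hψ'⟩ := exists_transvection hs (e := f₁) (a := -x) (q := q) h.ff
    (by simp [hxf]) (by simp [hq])
  have hψw : ∃ k : ℤ, ψ w = e₁ + k • f₁ := by
    refine ⟨B w e₁ + B w x - q, ?_⟩
    rw [hψ', h1, map_neg]
    simp only [x]
    module
  obtain ⟨k, hk⟩ := hψw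
  have : k = 0 := by
    have h2 := hψ w w
    rw [hk, hww] at h2
    simp [h.ee, h.ff, h.ef, hs f₁ e₁] at h2
    omega
  refine ⟨φ.trans ψ, hφ.trans hψ, ?_⟩
  rw [LinearEquiv.trans_apply, ← hw, hk, this]; simp

/-- Isometries act transitively on hyperbolic pairs when the lattice splits two hyperbolic
planes. -/
theorem exists_isometry_pair {B : Bil G} (hs : ∀ x y, B x y = B y x)
    (hev : ∀ x, ∃ q, B x x = 2 * q)
    {e₁ f₁ e₂ f₂ : G} (h : TwoHyp B e₁ f₁ e₂ f₂) (v g : G) (hv : B v v = 0)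
    (hg : B g g = 0) (hvg : B v g = 1) : ∃ φ, IsIsometry B φ ∧ φ v = e₁ ∧ φ g = f₁ := by
  obtain ⟨φ, hφ, h1⟩ := exists_isometry_vec hs hev h v g hv hvg
  set w := φ g with hw
  have hww : B w w = 0 := by rw [hw, hφ, hg]
  have hew : B w e₁ = 1 := by rw [hs, ← h1, hφ, hvg]
  let x := w - f₁ - B w f₁ • e₁
  obtain ⟨q, hq⟩ := hev x
  have hxf : B x f₁ = 0 := by simp [x, h.ef, h.ff]
  have hxe : B x e₁ = 0 := by simp [x, hs f₁ e₁, h.ef, h.ee, hew]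
  obtain ⟨ψ, hψ, hψ'⟩ := exists_transvection hs (e := e₁) (a := -x) (q := q) h.ee
    (by simp [hxe]) (by simp [hq])
  have hψw : ∃ k : ℤ, ψ w = f₁ + k • e₁ := by
    refine ⟨B w f₁ + B w x - q, ?_⟩
    rw [hψ', hew, map_neg]
    simp only [x]
    module
  obtain ⟨k, hk⟩ := hψw
  have : k = 0 := by
    have h2 := hψ w w
    rw [hk, hww] at h2
    simp [h.ee, h.ff, h.ef, hs f₁ e₁] at h2
    omega
  refine ⟨φ.trans ψ, hφ.trans hψ, ?_, ?_⟩
  · rw [LinearEquiv.trans_apply, h1, hψ', map_neg, hs e₁ x, hxe, h.ee]; simp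
  · rw [LinearEquiv.trans_apply, ← hw, hk, this]; simp

end Eichler

section Forms

variable {G₁ G₂ : Type} [AddCommGroup G₁] [AddCommGroup G₂]

theorem prodForm_apply (B₁ : Bil G₁) (B₂ : Bil G₂) (u v : G₁ × G₂) :
    prodForm B₁ B₂ u v = B₁ u.1 v.1 + B₂ u.2 v.2 := rfl

theorem HForm_apply (x y : Fin 2 → ℤ) : HForm x y = x 0 * y 1 + x 1 * y 0 := rfl

theorem prodForm_symm {B₁ : Bil G₁} {B₂ : Bil G₂} (h₁ : ∀ x y, B₁ x y = B₁ y x)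
    (h₂ : ∀ x y, B₂ x y = B₂ y x) (x y : G₁ × G₂) :
    prodForm B₁ B₂ x y = prodForm B₁ B₂ y x := by
  rw [prodForm_apply, prodForm_apply, h₁, h₂]

theorem prodForm_even {B₁ : Bil G₁} {B₂ : Bil G₂} (h₁ : ∀ x, ∃ q, B₁ x x = 2 * q)
    (h₂ : ∀ x, ∃ q, B₂ x x = 2 * q) (x : G₁ × G₂) : ∃ q, prodForm B₁ B₂ x x = 2 * q := by
  obtain ⟨p, hp⟩ := h₁ x.1
  obtain ⟨q, hq⟩ := h₂ x.2
  exact ⟨p + q, by rw [prodForm_apply, hp, hq]; ring⟩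

theorem HForm_symm (x y : Fin 2 → ℤ) : HForm x y = HForm y x := by
  rw [HForm_apply, HForm_apply]; ring

theorem HForm_even (x : Fin 2 → ℤ) : ∃ q, HForm x x = 2 * q :=
  ⟨x 0 * x 1, by rw [HForm_apply]; ring⟩

theorem E8Form_apply (x y : Fin 8 → ℤ) : E8Form x y =
    -2 * (x 0 * y 0 + x 1 * y 1 + x 2 * y 2 + x 3 * y 3 + x 4 * y 4 + x 5 * y 5 + x 6 * y 6
      + x 7 * y 7)
    + (x 0 * y 2 + x 2 * y 0) + (x 1 * y 3 + x 3 * y 1) + (x 2 * y 3 + x 3 * y 2)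
    + (x 3 * y 4 + x 4 * y 3) + (x 4 * y 5 + x 5 * y 4) + (x 5 * y 6 + x 6 * y 5)
    + (x 6 * y 7 + x 7 * y 6) := by
  simp [E8Form, E8Gram, Matrix.toLinearMap₂'_apply, Fin.sum_univ_eight]
  ring

theorem E8Form_symm (x y : Fin 8 → ℤ) : E8Form x y = E8Form y x := by
  rw [E8Form_apply, E8Form_apply]; ring

theorem E8Form_even (x : Fin 8 → ℤ) : ∃ q, E8Form x x = 2 * q :=
  ⟨-(x 0 ^ 2 + x 1 ^ 2 + x 2 ^ 2 + x 3 ^ 2 + x 4 ^ 2 + x 5 ^ 2 + x 6 ^ 2 + x 7 ^ 2)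
    + x 0 * x 2 + x 1 * x 3 + x 2 * x 3 + x 3 * x 4 + x 4 * x 5 + x 5 * x 6 + x 6 * x 7, by
    rw [E8Form_apply]; ring⟩

theorem E8Form_squares (x : Fin 8 → ℤ) : 60 * E8Form x x =
    -(30 * (2 * x 0 - x 2) ^ 2 + 30 * (2 * x 1 - x 3) ^ 2 + 10 * (3 * x 2 - 2 * x 3) ^ 2
      + 2 * (5 * x 3 - 6 * x 4) ^ 2 + 3 * (4 * x 4 - 5 * x 5) ^ 2 + 5 * (3 * x 5 - 4 * x 6) ^ 2
      + 10 * (2 * x 6 - 3 * x 7) ^ 2 + 30 * x 7 ^ 2) := by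
  rw [E8Form_apply]; ring

/-- Negative definiteness. -/
def NegDef (B : Bil G₁) : Prop := ∀ x, x ≠ 0 → B x x < 0

theorem E8Form_negDef : NegDef E8Form := by
  intro x hx
  by_contra hneg
  have h := E8Form_squares x
  have h0 := sq_nonneg (2 * x 0 - x 2)
  have h1 := sq_nonneg (2 * x 1 - x 3)
  have h2 := sq_nonneg (3 * x 2 - 2 * x 3)
  have h3 := sq_nonneg (5 * x 3 - 6 * x 4)
  have h4 := sq_nonneg (4 * x 4 - 5 * x 5)
  have h5 := sq_nonneg (3 * x 5 - 4 * x 6)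
  have h6 := sq_nonneg (2 * x 6 - 3 * x 7)
  have h7 := sq_nonneg (x 7)
  have e0 : 2 * x 0 - x 2 = 0 := pow_eq_zero_iff two_ne_zero |>.1 (by linarith)
  have e1 : 2 * x 1 - x 3 = 0 := pow_eq_zero_iff two_ne_zero |>.1 (by linarith)
  have e2 : 3 * x 2 - 2 * x 3 = 0 := pow_eq_zero_iff two_ne_zero |>.1 (by linarith)
  have e3 : 5 * x 3 - 6 * x 4 = 0 := pow_eq_zero_iff two_ne_zero |>.1 (by linarith)
  have e4 : 4 * x 4 - 5 * x 5 = 0 := pow_eq_zero_iff two_ne_zero |>.1 (by linarith)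
  have e5 : 3 * x 5 - 4 * x 6 = 0 := pow_eq_zero_iff two_ne_zero |>.1 (by linarith)
  have e6 : 2 * x 6 - 3 * x 7 = 0 := pow_eq_zero_iff two_ne_zero |>.1 (by linarith)
  have e7 : x 7 = 0 := pow_eq_zero_iff two_ne_zero |>.1 (by linarith)
  refine hx (funext fun i => ?_)
  fin_cases i <;> simp <;> omega

theorem NegDef.prodForm {B₁ : Bil G₁} {B₂ : Bil G₂} (h₁ : NegDef B₁) (h₂ : NegDef B₂) :
    NegDef (prodForm B₁ B₂) := by
  rintro ⟨x, y⟩ hxy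
  rw [prodForm_apply]
  have hx : B₁ x x ≤ 0 := by
    rcases eq_or_ne x 0 with rfl | hx
    · simp
    · exact (h₁ x hx).le
  have hy : B₂ y y ≤ 0 := by
    rcases eq_or_ne y 0 with rfl | hy
    · simp
    · exact (h₂ y hy).le
  rcases eq_or_ne x 0 with rfl | hx'
  · have := h₂ y (by rintro rfl; exact hxy rfl)
    simpa using this
  · have := h₁ x hx'
    simp only
    linarith

/-- In `H ⊕ (negative definite)`, the orthogonal complement of a vector of positive square is
negative definite. -/
theorem neg_of_perp_pos {C : Bil G₂} (hs : ∀ x y, C x y = C y x) (hC : NegDef C)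
    (v y : (Fin 2 → ℤ) × G₂) (hv : 0 < prodForm HForm C v v) (hvy : prodForm HForm C v y = 0)
    (hy : y ≠ 0) : prodForm HForm C y y < 0 := by
  obtain ⟨p, x⟩ := v
  obtain ⟨r, z⟩ := y
  simp only [prodForm_apply, HForm_apply] at hv hvy ⊢
  have hC0 : ∀ u, C u u ≤ 0 := fun u => by
    rcases eq_or_ne u 0 with rfl | hu
    · simp
    · exact (hC u hu).le
  have hx := hC0 x
  have hab : 0 < p 0 * p 1 := by linarith
  by_contra hneg
  rcases eq_or_ne z 0 with rfl | hz
  · simp at hvy hneg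
    have h1 : p 0 * r 1 = -(p 1 * r 0) := by linarith
    have hcd : 0 ≤ r 0 * r 1 := by linarith
    have h2 : (p 0 * r 1) ^ 2 = -((p 0 * p 1) * (r 0 * r 1)) := by
      rw [sq]; nth_rewrite 2 [h1]; ring
    have h3 : (p 0 * r 1) ^ 2 = 0 :=
      le_antisymm (by rw [h2]; have := mul_nonneg hab.le hcd; linarith) (sq_nonneg _)
    have h4 : p 0 * r 1 = 0 := pow_eq_zero_iff two_ne_zero |>.1 h3
    have h5 : p 1 * r 0 = 0 := by linarith
    have hp0 : p 0 ≠ 0 := by rintro h; simp [h] at hab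
    have hp1 : p 1 ≠ 0 := by rintro h; simp [h] at hab
    have h6 : r 1 = 0 := by simpa [hp0] using h4
    have h7 : r 0 = 0 := by simpa [hp1] using h5
    apply hy
    ext i
    · fin_cases i <;> simp [h6, h7]
    · rfl
  · have hz' := hC z hz
    have hcs : C x z ^ 2 ≤ C x x * C z z := by
      have h1 := hC0 (C z z • x - C x z • z)
      simp only [map_sub, map_smul, LinearMap.sub_apply, LinearMap.smul_apply, smul_eq_mul,
        hs z x] at h1
      have h2 : C z z * (C x x * C z z - C x z ^ 2) ≤ 0 := by linarith
      have := nonneg_of_mul_nonpos_right h2 hz'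
      linarith
    have hcd : -C z z ≤ 2 * (r 0 * r 1) := by linarith
    have h1 : C x z = -(p 0 * r 1 + p 1 * r 0) := by linarith
    rw [h1] at hcs
    have h2 : -C x x < 2 * (p 0 * p 1) := by linarith
    nlinarith [sq_nonneg (p 0 * r 1 - p 1 * r 0)]

theorem twoHyp_standard (C : Bil G₂) :
    TwoHyp (prodForm HForm (prodForm HForm C)) (![1, 0], 0, 0) (![0, 1], 0, 0)
      (0, ![1, 0], 0) (0, ![0, 1], 0) := by
  constructor <;> simp [prodForm_apply, HForm_apply]

/-- Any two orthogonal hyperbolic planes in `H ⊕ H ⊕ H ⊕ C`, with `C` even, can be moved to the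
first two summands. -/
theorem exists_isometry_twoHyp {C : Bil G₂} (hs : ∀ x y, C x y = C y x)
    (hev : ∀ x, ∃ q, C x x = 2 * q)
    {e₁ g₁ e₂ g₂ : (Fin 2 → ℤ) × (Fin 2 → ℤ) × (Fin 2 → ℤ) × G₂}
    (h : TwoHyp (prodForm HForm (prodForm HForm (prodForm HForm C))) e₁ g₁ e₂ g₂) :
    ∃ φ, IsIsometry (prodForm HForm (prodForm HForm (prodForm HForm C))) φ ∧
      φ e₁ = (![1, 0], 0, 0, 0) ∧ φ g₁ = (![0, 1], 0, 0, 0) ∧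
      φ e₂ = (0, ![1, 0], 0, 0) ∧ φ g₂ = (0, ![0, 1], 0, 0) := by
  have hsD := prodForm_symm HForm_symm (prodForm_symm HForm_symm hs)
  have hevD := prodForm_even HForm_even (prodForm_even HForm_even hev)
  have hsB := prodForm_symm HForm_symm hsD
  have hevB := prodForm_even HForm_even hevD
  obtain ⟨φ, hφ, hφe, hφg⟩ := exists_isometry_pair hsB hevB (twoHyp_standard _) e₁ g₁
    h.ee h.ff h.ef
  have hfst : ∀ y, prodForm HForm (prodForm HForm (prodForm HForm C)) e₁ y = 0 →
      prodForm HForm (prodForm HForm (prodForm HForm C)) g₁ y = 0 → (φ y).1 = 0 := by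
    intro y h1 h2
    rw [← hφ, hφe] at h1
    rw [← hφ, hφg] at h2
    simp [prodForm_apply, HForm_apply] at h1 h2
    funext i
    fin_cases i <;> simp [h1, h2]
  have he := hfst e₂ h.e₁e₂ h.f₁e₂
  have hg := hfst g₂ h.e₁f₂ h.f₁f₂
  have hee := h.ee'
  have hff := h.ff'
  have hef := h.ef'
  rw [← hφ, prodForm_apply, he] at hee hef
  rw [← hφ, prodForm_apply, hg] at hff
  simp only [map_zero, LinearMap.zero_apply, zero_add] at hee hff hef
  obtain ⟨ψ, hψ, hψe, hψg⟩ := exists_isometry_pair hsD hevD (twoHyp_standard _) (φ e₂).2 (φ g₂).2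
    hee hff hef
  refine ⟨φ.trans ((LinearEquiv.refl ℤ _).prodCongr ψ), hφ.trans fun x y => ?_, ?_, ?_, ?_, ?_⟩
  · change HForm x.1 y.1 + prodForm HForm (prodForm HForm C) (ψ x.2) (ψ y.2) = _
    rw [hψ, ← prodForm_apply]
  · rw [LinearEquiv.trans_apply, hφe]
    exact Prod.ext rfl (map_zero ψ)
  · rw [LinearEquiv.trans_apply, hφg]
    exact Prod.ext rfl (map_zero ψ)
  · ext1
    · simpa using he
    · simpa using hψe
  · ext1
    · simpa using hg
    · simpa using hψg

/-- The orthogonal complement of two orthogonal hyperbolic planes in `H ⊕ H ⊕ H ⊕ C`. -/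
theorem exists_complement {C : Bil G₂} (hs : ∀ x y, C x y = C y x)
    (hev : ∀ x, ∃ q, C x x = 2 * q)
    {e₁ g₁ e₂ g₂ : (Fin 2 → ℤ) × (Fin 2 → ℤ) × (Fin 2 → ℤ) × G₂}
    {B : Bil ((Fin 2 → ℤ) × (Fin 2 → ℤ) × (Fin 2 → ℤ) × G₂)}
    (hB : B = prodForm HForm (prodForm HForm (prodForm HForm C)))
    (h : TwoHyp B e₁ g₁ e₂ g₂) :
    ∃ j : (Fin 2 → ℤ) × G₂ →ₗ[ℤ] (Fin 2 → ℤ) × (Fin 2 → ℤ) × (Fin 2 → ℤ) × G₂,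
      Function.Injective j ∧ (∀ u v, B (j u) (j v) = prodForm HForm C u v) ∧
      (∀ u, B (j u) e₁ = 0 ∧ B (j u) g₁ = 0 ∧ B (j u) e₂ = 0 ∧ B (j u) g₂ = 0) ∧
      ∀ x, ∃ u, x = B x g₁ • e₁ + B x e₁ • g₁ + B x g₂ • e₂ + B x e₂ • g₂ + j u := by
  subst hB
  obtain ⟨φ, hφ, h1, h2, h3, h4⟩ := exists_isometry_twoHyp hs hev h
  refine ⟨φ.symm.toLinearMap ∘ₗ LinearMap.inr ℤ _ _ ∘ₗ LinearMap.inr ℤ _ _, ?_, ?_, ?_, ?_⟩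
  · exact φ.symm.injective.comp (LinearMap.inr_injective.comp LinearMap.inr_injective)
  · intro u v
    rw [← hφ]
    simp [prodForm_apply]
  · intro u
    rw [← hφ, ← hφ _ g₁, ← hφ _ e₂, ← hφ _ g₂, h1, h2, h3, h4]
    simp [prodForm_apply]
  · intro x
    refine ⟨(φ x).2.2, φ.injective ?_⟩
    rw [← hφ x, ← hφ x e₁, ← hφ x g₂, ← hφ x e₂]
    simp only [map_add, map_smul, h1, h2, h3, h4]
    ext i
    · fin_cases i <;> simp [prodForm_apply, HForm_apply]
    · fin_cases i <;> simp [prodForm_apply, HForm_apply]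
    all_goals simp

end Forms

end DF

open DF in
/-- Let `L` be a nondegenerate primitive sublattice of the K3
lattice of signature `(1, rank L - 1)`, and let `I` be a doubly admissible
primitive rank-2 isotropic sublattice of `L^⊥`. Then:
(1) there is a primitive isometric embedding `j : H ⊕ E₈ ⊕ E₈ ↪ I^⊥` with
`L ⊆ im j`, whose composition with the quotient map `I^⊥ → I^⊥/I` is an
isomorphism of lattices; in particular `L` embeds primitively into `I^⊥/I`;
(2) there is an orthogonal direct-sum decomposition `L^⊥ = M ⊕ Γ` with `M`
a primitive sublattice of `L^⊥` isometric to `H ⊕ H` containing `I` as a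
primitive sublattice, and `Γ` negative definite. -/
theorem stmt15 (L : Submodule ℤ K3type) (hLnd : NondegOn K3Form L) (hLprim : PrimSub L)
    (hLsig : SigOneRest K3Form L)
    (I : Submodule ℤ K3type) (hIle : I ≤ perpSub K3Form L)
    (hIprim : PrimIn I (perpSub K3Form L)) (hIiso : IsotropicSub K3Form I)
    (hIrk : Module.finrank ℤ ↥I = 2)
    (hda : DoublyAdm K3Form (perpSub K3Form L) I) :
    -- (1)
    (∃ (j : HEEtype →ₗ[ℤ] K3type) (hr : LinearMap.range j ≤ perpSub K3Form I),
      Function.Injective j ∧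
      (∀ u v, K3Form (j u) (j v) = HEEForm u v) ∧
      PrimIn (LinearMap.range j) (perpSub K3Form I) ∧
      L ≤ LinearMap.range j ∧
      -- the composition `H ⊕ E₈ ⊕ E₈ ↪ I^⊥ → I^⊥/I` is an isomorphism
      Function.Bijective (fun u : HEEtype =>
        (Submodule.Quotient.mk
          (⟨j u, hr (LinearMap.mem_range_self j u)⟩ : ↥(perpSub K3Form I)) :
          ↥(perpSub K3Form I) ⧸ Submodule.comap (perpSub K3Form I).subtype I)) ∧
      -- in particular, `L` embeds primitively into `I^⊥/I`:
      (∀ x : ↥(perpSub K3Form I), (x : K3type) ∈ L →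
        (Submodule.Quotient.mk x :
          ↥(perpSub K3Form I) ⧸ Submodule.comap (perpSub K3Form I).subtype I) = 0 →
        (x : K3type) = 0) ∧
      (∀ (n : ℤ) (y : ↥(perpSub K3Form I)), n ≠ 0 →
        (∃ x : ↥(perpSub K3Form I), (x : K3type) ∈ L ∧
          n • (Submodule.Quotient.mk y :
            ↥(perpSub K3Form I) ⧸ Submodule.comap (perpSub K3Form I).subtype I) =
            Submodule.Quotient.mk x) →
        ∃ x : ↥(perpSub K3Form I), (x : K3type) ∈ L ∧
          (Submodule.Quotient.mk y :
            ↥(perpSub K3Form I) ⧸ Submodule.comap (perpSub K3Form I).subtype I) =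
            Submodule.Quotient.mk x)) ∧
    -- (2)
    (∃ M Γ : Submodule ℤ K3type,
      M ≤ perpSub K3Form L ∧ Γ ≤ perpSub K3Form L ∧
      PrimIn M (perpSub K3Form L) ∧
      I ≤ M ∧ PrimIn I M ∧
      IsometricTo K3Form M HHForm ∧
      -- orthogonal direct sum decomposition `L^⊥ = M ⊕ Γ`:
      (∀ x ∈ M, ∀ y ∈ Γ, K3Form x y = 0) ∧
      M ⊓ Γ = ⊥ ∧
      (∀ z ∈ perpSub K3Form L, ∃ x ∈ M, ∃ y ∈ Γ, z = x + y) ∧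
      -- `Γ` is negative definite:
      (∀ y ∈ Γ, y ≠ 0 → K3Form y y < 0)) := by
  have hs : ∀ x y, K3Form x y = K3Form y x :=
    prodForm_symm HForm_symm (prodForm_symm HForm_symm (prodForm_symm HForm_symm
      (prodForm_symm E8Form_symm E8Form_symm)))
  obtain ⟨e₁, e₂, g₁, g₀, he₁, he₂, hg₁, hg₀, -, -, rfl, hgg₁, hgg₀, heg₁, heg₀, he₁g₀, he₂g₁⟩ :=
    hda
  have hm₁ : e₁ ∈ Submodule.span ℤ {e₁, e₂} := Submodule.subset_span (by simp)
  have hm₂ : e₂ ∈ Submodule.span ℤ {e₁, e₂} := Submodule.subset_span (by simp)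
  obtain ⟨g₂, hg₂, hT⟩ : ∃ g₂ ∈ perpSub K3Form L, TwoHyp K3Form e₁ g₁ e₂ g₂ := by
    have h12 : K3Form e₁ e₂ = 0 := hIiso _ hm₁ _ hm₂
    have h11 : K3Form e₁ e₁ = 0 := hIiso _ hm₁ _ hm₁
    refine ⟨g₀ - K3Form g₁ g₀ • e₁, sub_mem hg₀ (Submodule.smul_mem _ _ he₁),
      h11, hgg₁, heg₁, hIiso _ hm₂ _ hm₂, ?_, ?_, h12, ?_, by rw [hs, he₂g₁], ?_⟩ <;>
    simp [-zsmul_eq_mul, h11, hgg₀, heg₀, he₁g₀, hs g₀ e₁, hs e₂ e₁, h12, hs g₁ e₁, heg₁]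
  clear hg₀ hgg₀ heg₀ he₁g₀ g₀
  obtain ⟨j, hinj, hiso, hperp, hdec⟩ : ∃ j : HEEtype →ₗ[ℤ] K3type, Function.Injective j ∧
      (∀ u v, K3Form (j u) (j v) = HEEForm u v) ∧
      (∀ u, K3Form (j u) e₁ = 0 ∧ K3Form (j u) g₁ = 0 ∧ K3Form (j u) e₂ = 0 ∧
        K3Form (j u) g₂ = 0) ∧
      ∀ x, ∃ u, x = K3Form x g₁ • e₁ + K3Form x e₁ • g₁ + K3Form x g₂ • e₂ + K3Form x e₂ • g₂
        + j u := exists_complement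
    (prodForm_symm E8Form_symm E8Form_symm) (prodForm_even E8Form_even E8Form_even) rfl hT
  have hge₁ : K3Form g₁ e₁ = 1 := by rw [hs, hT.ef]
  have hge₂ : K3Form g₂ e₂ = 1 := by rw [hs, hT.ef']
  have he₂e₁ : K3Form e₂ e₁ = 0 := by rw [hs, hT.e₁e₂]
  have hg₂e₁ : K3Form g₂ e₁ = 0 := by rw [hs, hT.e₁f₂]
  have he₂g₁ : K3Form e₂ g₁ = 0 := by rw [hs, hT.f₁e₂]
  have hg₂g₁ : K3Form g₂ g₁ = 0 := by rw [hs, hT.f₁f₂]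
  have hrange : ∀ x, x ∈ LinearMap.range j ↔
      K3Form x e₁ = 0 ∧ K3Form x g₁ = 0 ∧ K3Form x e₂ = 0 ∧ K3Form x g₂ = 0 := by
    refine fun x => ⟨?_, ?_⟩
    · rintro ⟨u, rfl⟩
      exact hperp u
    · rintro ⟨h1, h2, h3, h4⟩
      obtain ⟨u, hu⟩ := hdec x
      exact ⟨u, by rw [hu, h1, h2, h3, h4]; simp [-zsmul_eq_mul]⟩
  have hI : ∀ x, x ∈ perpSub K3Form (Submodule.span ℤ {e₁, e₂}) ↔
      K3Form x e₁ = 0 ∧ K3Form x e₂ = 0 := by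
    refine fun x => ⟨fun h => ⟨(h _ hm₁).2, (h _ hm₂).2⟩, ?_⟩
    rintro ⟨h1, h2⟩ s hsI
    obtain ⟨a, b, rfl⟩ := Submodule.mem_span_pair.1 hsI
    simp [-zsmul_eq_mul, hs e₁ x, hs e₂ x, h1, h2]
  have hI0 : ∀ x ∈ Submodule.span ℤ {e₁, e₂}, K3Form x g₁ = 0 → K3Form x g₂ = 0 → x = 0 := by
    intro x hx h1 h2
    obtain ⟨a, b, rfl⟩ := Submodule.mem_span_pair.1 hx
    simp [-zsmul_eq_mul, hT.ef, hT.ef', hT.e₁f₂, he₂g₁] at h1 h2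
    simp [-zsmul_eq_mul, h1, h2]
  have hIj : ∀ x u, x - j u ∈ Submodule.span ℤ {e₁, e₂} → K3Form x g₁ = 0 → K3Form x g₂ = 0 →
      x = j u := by
    intro x u hx h1 h2
    refine sub_eq_zero.1 (hI0 _ hx ?_ ?_) <;> simp [-zsmul_eq_mul, h1, h2, hperp u]
  have hLj : L ≤ LinearMap.range j := fun x hx => (hrange x).2
    ⟨(he₁ x hx).1, (hg₁ x hx).1, (he₂ x hx).1, (hg₂ x hx).1⟩
  have hjI : LinearMap.range j ≤ perpSub K3Form (Submodule.span ℤ {e₁, e₂}) := fun x hx => by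
    obtain ⟨h1, -, h2, -⟩ := (hrange x).1 hx
    exact (hI x).2 ⟨h1, h2⟩
  have hdecI : ∀ x ∈ perpSub K3Form (Submodule.span ℤ {e₁, e₂}),
      ∃ u, x - j u ∈ Submodule.span ℤ {e₁, e₂} := by
    intro x hx
    obtain ⟨h1, h2⟩ := (hI x).1 hx
    obtain ⟨u, hu⟩ := hdec x
    rw [h1, h2] at hu
    exact ⟨u, Submodule.mem_span_pair.2 ⟨K3Form x g₁, K3Form x g₂, by
      nth_rewrite 3 [hu]; simp [-zsmul_eq_mul]⟩⟩
  have hLg : ∀ x ∈ L, K3Form x g₁ = 0 ∧ K3Form x g₂ = 0 := fun x hx =>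
    ⟨(hg₁ x hx).1, (hg₂ x hx).1⟩
  constructor
  · refine ⟨j, hjI, hinj, hiso, ?_, hLj, ⟨?_, ?_⟩, ?_, ?_⟩
    · intro n x hn _ hx
      rw [hrange] at hx ⊢
      simpa [-zsmul_eq_mul, hn] using hx
    · intro u v huv
      have h1 := (Submodule.Quotient.eq _).1 huv
      exact hinj (hIj _ _ (by simpa [-zsmul_eq_mul] using h1) (hperp u).2.1 (hperp u).2.2.2)
    · intro y
      obtain ⟨x, rfl⟩ := Submodule.Quotient.mk_surjective _ y
      obtain ⟨u, hu⟩ := hdecI x x.2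
      exact ⟨u, ((Submodule.Quotient.eq _).2 (by simpa [-zsmul_eq_mul] using hu)).symm⟩
    · intro x hx h0
      have h1 := (Submodule.Quotient.mk_eq_zero _).1 h0
      exact hI0 x (by simpa [-zsmul_eq_mul] using h1) (hLg x hx).1 (hLg x hx).2
    · rintro n y hn ⟨x, hx, hxy⟩
      obtain ⟨u, hu⟩ := hdecI y y.2
      have h1 := (Submodule.Quotient.eq _).1 hxy.symm
      have h2 : (x : K3type) - n • (y : K3type) ∈ Submodule.span ℤ {e₁, e₂} := by simpa [-zsmul_eq_mul] using h1
      have h3 : (x : K3type) = j (n • u) := by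
        refine hIj _ _ ?_ (hLg x hx).1 (hLg x hx).2
        have := add_mem h2 (Submodule.smul_mem _ n hu)
        rw [map_smul]
        convert this using 1
        module
      have h4 : j u ∈ L := hLprim n _ hn (by rw [← map_smul, ← h3]; exact hx)
      exact ⟨⟨j u, hjI ⟨u, rfl⟩⟩, h4, (Submodule.Quotient.eq _).2 (by simpa [-zsmul_eq_mul] using hu)⟩
  · obtain ⟨-, v₀, -, hv₀, -, hpos, -⟩ := hLsig
    let m : HHtype →ₗ[ℤ] K3type :=
      LinearMap.coprod
        ((LinearMap.proj 0).smulRight e₁ + (LinearMap.proj 1).smulRight g₁)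
        ((LinearMap.proj 0).smulRight e₂ + (LinearMap.proj 1).smulRight g₂)
    have hm : ∀ u, m u = u.1 0 • e₁ + u.1 1 • g₁ + (u.2 0 • e₂ + u.2 1 • g₂) := fun u => by
      simp [-zsmul_eq_mul, m]
    have hm0 : ∀ u, K3Form (m u) e₁ = u.1 1 ∧ K3Form (m u) g₁ = u.1 0 ∧
        K3Form (m u) e₂ = u.2 1 ∧ K3Form (m u) g₂ = u.2 0 := fun u => by
      simp [-zsmul_eq_mul, hm, hT.ee, hT.ff, hT.ef, hT.ee', hT.ff', hT.ef', hT.e₁e₂, hT.e₁f₂, hT.f₁e₂, hT.f₁f₂,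
        hge₁, hge₂, he₂e₁, hg₂e₁, he₂g₁, hg₂g₁]
    have hmiso : ∀ u v, K3Form (m u) (m v) = HHForm u v := fun u v => by
      obtain ⟨h1, h2, h3, h4⟩ := hm0 u
      rw [hm v]
      simp only [map_add, map_smul, h1, h2, h3, h4, smul_eq_mul, HHForm, prodForm_apply,
        HForm_apply]
      ring
    have hminj : Function.Injective m := fun u v huv => by
      obtain ⟨h1, h2, h3, h4⟩ := hm0 u
      obtain ⟨k1, k2, k3, k4⟩ := hm0 v
      rw [huv] at h1 h2 h3 h4
      ext i <;> fin_cases i <;> simp <;> omega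
    have hmL : LinearMap.range m ≤ perpSub K3Form L := by
      rintro _ ⟨u, rfl⟩
      rw [hm]
      exact add_mem (add_mem (Submodule.smul_mem _ _ he₁) (Submodule.smul_mem _ _ hg₁))
        (add_mem (Submodule.smul_mem _ _ he₂) (Submodule.smul_mem _ _ hg₂))
    have hmj : ∀ u v, K3Form (m u) (j v) = 0 := fun u v => by
      obtain ⟨h1, h2, h3, h4⟩ := hperp v
      rw [hs, hm]
      simp [-zsmul_eq_mul, h1, h2, h3, h4]
    have hdec' : ∀ x, ∃ u v, x = m u + j v := fun x => by
      obtain ⟨v, hv⟩ := hdec x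
      refine ⟨(![K3Form x g₁, K3Form x e₁], ![K3Form x g₂, K3Form x e₂]), v, ?_⟩
      rw [hm]
      nth_rewrite 1 [hv]
      simp [-zsmul_eq_mul, add_assoc]
    have hjm : ∀ v, j v ∈ LinearMap.range m → j v = 0 := by
      rintro v ⟨u, hu⟩
      obtain ⟨h1, h2, h3, h4⟩ := hm0 u
      rw [hu] at h1 h2 h3 h4
      obtain ⟨k1, k2, k3, k4⟩ := hperp v
      rw [← hu, hm, ← h1, ← h2, ← h3, ← h4, k1, k2, k3, k4]
      simp [-zsmul_eq_mul]
    refine ⟨LinearMap.range m, perpSub K3Form L ⊓ LinearMap.range j, hmL, inf_le_left, ?_, ?_,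
      fun n x hn hx => hIprim n x hn (hmL hx), ⟨LinearEquiv.ofInjective m hminj, hmiso⟩, ?_, ?_,
      ?_, ?_⟩
    · intro n x hn _ hx
      obtain ⟨u, v, rfl⟩ := hdec' x
      have h1 : j (n • v) ∈ LinearMap.range m := by
        have := sub_mem hx ⟨n • u, rfl⟩
        simpa [-zsmul_eq_mul] using this
      have h2 := hjm _ h1
      rw [map_smul, smul_eq_zero_iff_right hn] at h2
      rw [h2, add_zero]
      exact ⟨u, rfl⟩
    · rw [Submodule.span_le]
      rintro x (rfl | rfl)
      · exact ⟨(![1, 0], 0), by simp [-zsmul_eq_mul, hm]⟩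
      · exact ⟨(0, ![1, 0]), by simp [-zsmul_eq_mul, hm]⟩
    · rintro _ ⟨u, rfl⟩ _ ⟨-, ⟨v, rfl⟩⟩
      exact hmj u v
    · rw [eq_bot_iff]
      rintro _ ⟨hx, -, ⟨v, rfl⟩⟩
      exact hjm v hx
    · intro z hz
      obtain ⟨u, v, rfl⟩ := hdec' z
      refine ⟨m u, ⟨u, rfl⟩, j v, ⟨?_, ⟨v, rfl⟩⟩, rfl⟩
      simpa [-zsmul_eq_mul] using sub_mem hz (hmL ⟨u, rfl⟩)
    · rintro _ ⟨hy, ⟨v, rfl⟩⟩ hy0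
      obtain ⟨w, rfl⟩ := hLj hv₀
      have h0 := (hy _ hv₀).1
      rw [hiso] at hpos h0 ⊢
      exact neg_of_perp_pos (prodForm_symm E8Form_symm E8Form_symm)
        (E8Form_negDef.prodForm E8Form_negDef) w v hpos h0 (by rintro rfl; exact hy0 (map_zero j))
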